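/- arXiv:2603.14575 — 2 statements merged into one kernel-verified Lean document; each statement's English description precedes it below -/
import Mathlib

section
/- Fix K ≥ 2, σ > 0, ε > 0 and δ ∈ (0, 1/4). Consider the unstructured K-armed Gaussian bandit class: instances are arbitrary mean vectors μ ∈ ℝ^K, and pulling arm i returns an observation distributed N(μ_i, σ²), independent across pulls. Let π be any policy with budget T (adaptive measurable arm-selection rules and a measurable recommendation rule producing a final arm p̂) such that for every instance μ ∈ ℝ^K, the probability that the simple regret max_i μ_i − μ_{p̂} is at most ε is at least 1−δ. Then T ≥ (K−1)·(σ²/(8ε²))·log(1/(2δ)). -/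
open MeasureTheory ProbabilityTheory

/-- The arm chosen at round `t` by the deterministic policy `select` when the full observation
sequence is `y : Fin T → ℝ` (the selection at round `t` depends only on the past observations
`y₀,…,y_{t−1}`). -/
def armProc {K T : ℕ} (select : (t : ℕ) → (Fin t → ℝ) → Fin K)
    (y : Fin T → ℝ) (t : Fin T) : Fin K :=
  select t (fun s => y ⟨s, s.2.trans t.2⟩)

/-- The law `P_ν` of the observation sequence `(y₀,…,y_{T−1})` of a `K`-armed Gaussian bandit
with mean vector `ν` and variance `v`, under the deterministic policy `select`: at each round `t`,
the arm `I_t = armProc select y t` is chosen from the past observations and `y_t ~ N(ν_{I_t}, v)`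
independently given the past; i.e., the measure with density `y ↦ ∏_t φ_{ν_{I_t(y)}, v}(y_t)`
with respect to Lebesgue measure on `ℝᵀ`. -/
noncomputable def banditLaw {K T : ℕ} (v : NNReal)
    (select : (t : ℕ) → (Fin t → ℝ) → Fin K) (ν : Fin K → ℝ) :
    Measure (Fin T → ℝ) :=
  (Measure.pi fun _ : Fin T => (volume : Measure ℝ)).withDensity
    (fun y => ∏ t, ENNReal.ofReal (gaussianPDFReal (ν (armProc select y t)) v (y t)))

noncomputable def bdens {K T : ℕ} (v : NNReal)
    (select : (t : ℕ) → (Fin t → ℝ) → Fin K) (ν : Fin K → ℝ) (y : Fin T → ℝ) : ℝ :=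
  ∏ t, gaussianPDFReal (ν (armProc select y t)) v (y t)

lemma bdens_nonneg {K T : ℕ} (v : NNReal)
    (select : (t : ℕ) → (Fin t → ℝ) → Fin K) (ν : Fin K → ℝ) (y : Fin T → ℝ) :
    0 ≤ bdens v select ν y :=
  Finset.prod_nonneg fun _ _ => gaussianPDFReal_nonneg _ _ _

lemma ofReal_bdens {K T : ℕ} (v : NNReal)
    (select : (t : ℕ) → (Fin t → ℝ) → Fin K) (ν : Fin K → ℝ) (y : Fin T → ℝ) :
    ENNReal.ofReal (bdens v select ν y) =
      ∏ t, ENNReal.ofReal (gaussianPDFReal (ν (armProc select y t)) v (y t)) :=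
  ENNReal.ofReal_prod_of_nonneg fun _ _ => gaussianPDFReal_nonneg _ _ _

lemma measurable_armProc {K T : ℕ} (select : (t : ℕ) → (Fin t → ℝ) → Fin K)
    (hsel : ∀ t, Measurable (select t)) (t : Fin T) :
    Measurable (fun y : Fin T → ℝ => armProc select y t) := by
  unfold armProc
  exact (hsel t).comp (measurable_pi_lambda _ fun s => measurable_pi_apply _)

lemma measurable_bdens {K T : ℕ} (v : NNReal)
    (select : (t : ℕ) → (Fin t → ℝ) → Fin K) (hsel : ∀ t, Measurable (select t))
    (ν : Fin K → ℝ) : Measurable (bdens (T := T) v select ν) := by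
  unfold bdens
  refine Finset.measurable_prod _ fun t _ => ?_
  have h1 : Measurable (fun y : Fin T → ℝ => ν (armProc select y t)) :=
    (measurable_of_finite ν).comp (measurable_armProc select hsel t)
  have h2 : Measurable (fun y : Fin T → ℝ => y t) := measurable_pi_apply t
  simp only [gaussianPDFReal]
  exact (((h2.sub h1).pow_const 2).neg.div_const _).exp.const_mul _

lemma lintegral_bdens {K : ℕ} (v : NNReal) (hv : v ≠ 0)
    (select : (t : ℕ) → (Fin t → ℝ) → Fin K) (hsel : ∀ t, Measurable (select t))
    (ν : Fin K → ℝ) (T : ℕ) :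
    ∫⁻ y : Fin T → ℝ, ENNReal.ofReal (bdens v select ν y)
      ∂(Measure.pi fun _ : Fin T => (volume : Measure ℝ)) = 1 := by
  induction T with
  | zero =>
    rw [Measure.pi_of_empty]
    simp [bdens]
  | succ T ih =>
    have hmp := measurePreserving_piFinSuccAbove
      (fun _ : Fin (T + 1) => (volume : Measure ℝ)) (Fin.last T)
    have hmp' := hmp.symm
    rw [← hmp'.lintegral_comp
      ((measurable_bdens v select hsel ν).ennreal_ofReal)]
    rw [lintegral_prod_symm]
    · rw [← ih]
      refine lintegral_congr fun y => ?_
      have key : ∀ x : ℝ, bdens v select ν ((MeasurableEquiv.piFinSuccAbove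
          (fun _ : Fin (T + 1) => ℝ) (Fin.last T)).symm (x, y)) =
          bdens v select ν y * gaussianPDFReal (ν (select T y)) v x := by
        intro x
        have e : (MeasurableEquiv.piFinSuccAbove
          (fun _ : Fin (T + 1) => ℝ) (Fin.last T)).symm (x, y) =
            (Fin.snoc (α := fun _ => ℝ) y x : Fin (T+1) → ℝ) := by
          exact Fin.insertNth_last' x y
        rw [e]
        unfold bdens
        rw [Fin.prod_univ_castSucc]
        congr 1
        · refine Finset.prod_congr rfl fun t _ => ?_
          have : armProc select (Fin.snoc (α := fun _ => ℝ) y x : Fin (T+1) → ℝ) t.castSucc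
              = armProc select y t := by
            unfold armProc
            congr 1
            funext s
            exact Fin.snoc_castSucc (α := fun _ => ℝ) x y ⟨s, s.2.trans t.2⟩
          rw [this, Fin.snoc_castSucc]
        · have : armProc select (Fin.snoc (α := fun _ => ℝ) y x : Fin (T+1) → ℝ) (Fin.last T)
              = select T y := by
            unfold armProc
            change select T _ = _
            congr 1
            funext s
            exact Fin.snoc_castSucc (α := fun _ => ℝ) x y s
          rw [this, Fin.snoc_last]
      simp_rw [key]
      simp_rw [ENNReal.ofReal_mul (bdens_nonneg v select ν y)]
      rw [lintegral_const_mul _ (measurable_gaussianPDFReal _ _).ennreal_ofReal,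
        lintegral_gaussianPDFReal_eq_one _ hv, mul_one]
    · exact ((measurable_bdens v select hsel ν).ennreal_ofReal.comp
        (MeasurableEquiv.measurable _)).aemeasurable

lemma integrable_bdens {K : ℕ} (v : NNReal) (hv : v ≠ 0)
    (select : (t : ℕ) → (Fin t → ℝ) → Fin K) (hsel : ∀ t, Measurable (select t))
    (ν : Fin K → ℝ) (T : ℕ) :
    Integrable (bdens (T := T) v select ν)
      (Measure.pi fun _ : Fin T => (volume : Measure ℝ)) := by
  refine ⟨(measurable_bdens v select hsel ν).aestronglyMeasurable, ?_⟩
  rw [hasFiniteIntegral_iff_ofReal (Filter.Eventually.of_forall (bdens_nonneg v select ν)),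
    lintegral_bdens v hv select hsel]
  simp

lemma integral_bdens {K : ℕ} (v : NNReal) (hv : v ≠ 0)
    (select : (t : ℕ) → (Fin t → ℝ) → Fin K) (hsel : ∀ t, Measurable (select t))
    (ν : Fin K → ℝ) (T : ℕ) :
    ∫ y, bdens (T := T) v select ν y
      ∂(Measure.pi fun _ : Fin T => (volume : Measure ℝ)) = 1 := by
  rw [integral_eq_lintegral_of_nonneg_ae
    (Filter.Eventually.of_forall (bdens_nonneg v select ν))
    (measurable_bdens v select hsel ν).aestronglyMeasurable, lintegral_bdens v hv select hsel]
  simp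

lemma banditLaw_le {K T : ℕ} (v : NNReal) (hv : v ≠ 0)
    (select : (t : ℕ) → (Fin t → ℝ) → Fin K) (hsel : ∀ t, Measurable (select t))
    (ν : Fin K → ℝ) (A : Set (Fin T → ℝ)) (hA : MeasurableSet A) (r : ℝ)
    (h : ENNReal.ofReal r ≤ banditLaw (T := T) v select ν A) :
    r ≤ ∫ y in A, bdens v select ν y ∂(Measure.pi fun _ : Fin T => (volume : Measure ℝ)) := by
  unfold banditLaw at h
  rw [withDensity_apply _ hA] at h
  simp_rw [← ofReal_bdens] at h
  rw [← ofReal_integral_eq_lintegral_ofReal (integrable_bdens v hv select hsel ν T).integrableOn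
    (Filter.Eventually.of_forall (bdens_nonneg v select ν))] at h
  exact (ENNReal.ofReal_le_ofReal_iff
    (integral_nonneg (bdens_nonneg v select ν))).1 h

/-- Number of pulls of arm `i`. -/
def bcount {K T : ℕ} (select : (t : ℕ) → (Fin t → ℝ) → Fin K) (i : Fin K)
    (y : Fin T → ℝ) : ℝ := ∑ t : Fin T, if armProc select y t = i then 1 else 0

lemma sum_bcount {K T : ℕ} (select : (t : ℕ) → (Fin t → ℝ) → Fin K) (y : Fin T → ℝ) :
    ∑ i, bcount select i y = T := by
  unfold bcount
  rw [Finset.sum_comm]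
  simp

lemma bdens_mul {K T : ℕ} (v : NNReal) (hv : v ≠ 0)
    (select : (t : ℕ) → (Fin t → ℝ) → Fin K) (i : Fin K) (d : ℝ) (y : Fin T → ℝ) :
    bdens v select (fun j => if j = i then d else 0) y *
      bdens v select (fun j => if j = i then -d else 0) y =
    (Real.exp (-(d ^ 2 / (2 * v)) * bcount select i y) * bdens v select (fun _ => 0) y) ^ 2 := by
  have hv' : (v : ℝ) ≠ 0 := by exact_mod_cast hv
  unfold bdens bcount
  rw [Finset.mul_sum, Real.exp_sum, ← Finset.prod_mul_distrib, ← Finset.prod_mul_distrib,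
    ← Finset.prod_pow]
  refine Finset.prod_congr rfl fun t _ => ?_
  by_cases h : armProc select y t = i
  · simp only [gaussianPDFReal, mul_pow, if_pos h]
    rw [← Real.exp_nat_mul, ← Real.exp_nat_mul, mul_mul_mul_comm, ← Real.exp_add, mul_left_comm,
      ← Real.exp_add, ← pow_two]
    congr 2
    push_cast
    field_simp
    ring
  · simp only [if_neg h, mul_zero, Real.exp_zero]
    ring

lemma sum_exp_ge {K : ℕ} (hK : 0 < K) (c S : ℝ) (n : Fin K → ℝ) (hn : ∑ i, n i = S) :
    K * Real.exp (-c * (S / K)) ≤ ∑ i, Real.exp (-c * n i) := by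
  have hK' : (0 : ℝ) < K := by exact_mod_cast hK
  have h : ∀ i, Real.exp (-c * (S / K)) * (1 + (-c * n i - -c * (S / K))) ≤
      Real.exp (-c * n i) := by
    intro i
    have := Real.add_one_le_exp (-c * n i - -c * (S / K))
    calc _ ≤ Real.exp (-c * (S / K)) * Real.exp (-c * n i - -c * (S / K)) := by
          gcongr; linarith
      _ = _ := by rw [← Real.exp_add]; congr 1; ring
  refine le_trans (le_of_eq ?_) (Finset.sum_le_sum fun i _ => h i)
  rw [← Finset.mul_sum, Finset.sum_add_distrib, Finset.sum_sub_distrib, ← Finset.mul_sum, hn]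
  simp
  field_simp
  ring

lemma amgm_aux (x p q s : ℝ) (hp : 0 ≤ p) (hq : 0 ≤ q) (hs : 0 < s) (h : p * q = x ^ 2) :
    x ≤ s / 2 * p + 1 / (2 * s) * q := by
  refine (abs_le_of_sq_le_sq' ?_ ?_).2
  · rw [← h]
    have e : (s / 2 * p + 1 / (2 * s) * q) ^ 2 = p * q + (s / 2 * p - 1 / (2 * s) * q) ^ 2 := by
      field_simp; ring
    rw [e]; nlinarith [sq_nonneg (s / 2 * p - 1 / (2 * s) * q)]
  · positivity

/-- Lower bound for the unstructured `K`-armed Gaussian bandit class. Fix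
`K ≥ 2`, `σ > 0`, `ε > 0`, `δ ∈ (0, 1/4)`, and a policy with budget `T` (measurable adaptive
arm-selection rules `select` and a measurable recommendation rule `rec`). If for every instance
`μ ∈ ℝᴷ` the simple regret `max_i μ_i − μ_{p̂}` is at most `ε` with probability at least `1−δ`,
then `T ≥ (K−1)·(σ²/(8ε²))·log(1/(2δ))`. -/
theorem bandit_best_arm_identification_lower_bound (K T : ℕ) (hK : 2 ≤ K)
    (σ ε δ : ℝ) (hσ : 0 < σ) (hε : 0 < ε) (hδ : δ ∈ Set.Ioo (0 : ℝ) (1 / 4))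
    (select : (t : ℕ) → (Fin t → ℝ) → Fin K) (hsel : ∀ t, Measurable (select t))
    (rec : (Fin T → ℝ) → Fin K) (hrec : Measurable rec)
    (hcorrect : ∀ μ : Fin K → ℝ,
      ENNReal.ofReal (1 - δ) ≤
        (banditLaw (T := T) ⟨σ ^ 2, sq_nonneg σ⟩ select μ)
          {y | (⨆ i : Fin K, μ i) - μ (rec y) ≤ ε}) :
    (K - 1 : ℝ) * (σ ^ 2 / (8 * ε ^ 2)) * Real.log (1 / (2 * δ)) ≤ T := by
  obtain ⟨hδ0, hδ4⟩ := hδ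
  set v : NNReal := ⟨σ ^ 2, sq_nonneg σ⟩ with hvdef
  have hvc : (v : ℝ) = σ ^ 2 := rfl
  have hv : v ≠ 0 := by
    intro h
    have : (v : ℝ) = 0 := by rw [h]; rfl
    rw [hvc] at this
    exact absurd this (by positivity)
  have hKpos : 0 < K := by omega
  have : Nonempty (Fin K) := ⟨⟨0, hKpos⟩⟩
  set d : ℝ := 7 / 5 * ε with hd
  have hdpos : 0 < d := by positivity
  have hdε : ε < d := by rw [hd]; linarith
  set s : ℝ := Real.sqrt δ with hs
  have hspos : 0 < s := Real.sqrt_pos.2 hδ0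
  have hs2 : s ^ 2 = δ := Real.sq_sqrt hδ0.le
  have hs12 : s < 1 / 2 := by nlinarith
  set M : Measure (Fin T → ℝ) := Measure.pi fun _ : Fin T => (volume : Measure ℝ) with hM
  let P : Fin K → (Fin T → ℝ) → ℝ := fun i => bdens v select (fun j => if j = i then d else 0)
  let Q : Fin K → (Fin T → ℝ) → ℝ := fun i => bdens v select (fun j => if j = i then -d else 0)
  let A : Fin K → Set (Fin T → ℝ) := fun i => rec ⁻¹' {i}
  have hA : ∀ i, MeasurableSet (A i) := fun i => hrec (measurableSet_singleton i)
  have hPi : ∀ i, Integrable (P i) M := fun i => integrable_bdens v hv select hsel _ T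
  have hQi : ∀ i, Integrable (Q i) M := fun i => integrable_bdens v hv select hsel _ T
  have hP : ∀ i, 1 - δ ≤ ∫ y in A i, P i y ∂M := by
    intro i
    refine banditLaw_le v hv select hsel _ _ (hA i) _ ((hcorrect _).trans (measure_mono ?_))
    intro y hy
    by_contra hne
    have hne' : rec y ≠ i := hne
    simp only [Set.mem_ofPred_eq, if_neg hne'] at hy
    have : d ≤ ⨆ j : Fin K, (if j = i then d else 0 : ℝ) :=
      le_ciSup_of_le (Set.finite_range _).bddAbove i (by simp)
    linarith
  have hQ : ∀ i, 1 - δ ≤ ∫ y in (A i)ᶜ, Q i y ∂M := by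
    intro i
    refine banditLaw_le v hv select hsel _ _ (hA i).compl _ ((hcorrect _).trans (measure_mono ?_))
    intro y hy hmem
    have he : rec y = i := hmem
    simp only [Set.mem_ofPred_eq, if_pos he] at hy
    have : Nontrivial (Fin K) := Fin.nontrivial_iff_two_le.2 hK
    obtain ⟨j, hj⟩ := exists_ne i
    have : 0 ≤ ⨆ j : Fin K, (if j = i then -d else 0 : ℝ) :=
      le_ciSup_of_le (Set.finite_range _).bddAbove j (by simp [hj])
    linarith
  have hP1 : ∀ i, (∫ y in A i, P i y ∂M) + ∫ y in (A i)ᶜ, P i y ∂M = 1 := fun i => by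
    rw [integral_add_compl (hA i) (hPi i)]; exact integral_bdens v hv select hsel _ T
  have hQ1 : ∀ i, (∫ y in A i, Q i y ∂M) + ∫ y in (A i)ᶜ, Q i y ∂M = 1 := fun i => by
    rw [integral_add_compl (hA i) (hQi i)]; exact integral_bdens v hv select hsel _ T
  let F : Fin K → (Fin T → ℝ) → ℝ := fun i y =>
    (A i).indicator (fun y => s / 2 * P i y + 1 / (2 * s) * Q i y) y +
    (A i)ᶜ.indicator (fun y => s / 2 * Q i y + 1 / (2 * s) * P i y) y
  have hF1 : ∀ i, Integrable ((A i).indicator (fun y => s / 2 * P i y + 1 / (2 * s) * Q i y)) M :=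
    fun i => (((hPi i).const_mul _).add ((hQi i).const_mul _)).indicator (hA i)
  have hF2 : ∀ i, Integrable ((A i)ᶜ.indicator (fun y => s / 2 * Q i y + 1 / (2 * s) * P i y)) M :=
    fun i => (((hQi i).const_mul _).add ((hPi i).const_mul _)).indicator (hA i).compl
  have hFi : ∀ i, Integrable (F i) M := fun i => (hF1 i).add (hF2 i)
  have hFint : ∀ i, ∫ y, F i y ∂M ≤ s * (2 - δ) := by
    intro i
    have e : ∫ y, F i y ∂M = (s / 2 * (∫ y in A i, P i y ∂M) + 1 / (2 * s) * ∫ y in A i, Q i y ∂M)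
        + (s / 2 * (∫ y in (A i)ᶜ, Q i y ∂M) + 1 / (2 * s) * ∫ y in (A i)ᶜ, P i y ∂M) := by
      have e1 : ∫ y, F i y ∂M = _ := integral_add (hF1 i) (hF2 i)
      rw [e1, integral_indicator (hA i), integral_indicator (hA i).compl,
        integral_add ((hPi i).const_mul _).integrableOn ((hQi i).const_mul _).integrableOn,
        integral_add ((hQi i).const_mul _).integrableOn ((hPi i).const_mul _).integrableOn]
      simp only [integral_const_mul]
    have h1 := hP i
    have h2 := hQ i
    have h3 := hP1 i
    have h4 := hQ1 i
    rw [e]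
    generalize (∫ y in A i, P i y ∂M) = a at *
    generalize (∫ y in (A i)ᶜ, P i y ∂M) = b at *
    generalize (∫ y in A i, Q i y ∂M) = a' at *
    generalize (∫ y in (A i)ᶜ, Q i y ∂M) = b' at *
    obtain rfl : b = 1 - a := by linarith
    obtain rfl : a' = 1 - b' := by linarith
    have hs1 : s / 2 ≤ 1 / (2 * s) := by
      rw [div_le_div_iff₀ (by norm_num) (by positivity)]; nlinarith
    have hδs : 1 / (2 * s) * δ = s / 2 := by
      rw [← hs2]; field_simp
    nlinarith [mul_nonneg (sub_nonneg.2 hs1) (sub_nonneg.2 h1),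
      mul_nonneg (sub_nonneg.2 hs1) (sub_nonneg.2 h2)]
  set c : ℝ := d ^ 2 / (2 * v) with hc
  have hFge : ∀ i y, Real.exp (-c * bcount select i y) * bdens v select (fun _ => 0) y ≤ F i y := by
    intro i y
    have hm := bdens_mul v hv select i d y
    have hp0 : 0 ≤ P i y := bdens_nonneg _ _ _ _
    have hq0 : 0 ≤ Q i y := bdens_nonneg _ _ _ _
    by_cases hy : y ∈ A i
    · have : F i y = s / 2 * P i y + 1 / (2 * s) * Q i y := by simp [F, hy]
      rw [this]
      exact amgm_aux _ _ _ _ hp0 hq0 hspos hm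
    · have : F i y = s / 2 * Q i y + 1 / (2 * s) * P i y := by simp [F, hy]
      rw [this]
      exact amgm_aux _ _ _ _ hq0 hp0 hspos ((mul_comm _ _).trans hm)
  have hpt : ∀ y, K * Real.exp (-c * (T / K)) * bdens v select (fun _ => 0) y ≤ ∑ i, F i y := by
    intro y
    refine le_trans ?_ (Finset.sum_le_sum fun i _ => hFge i y)
    rw [← Finset.sum_mul]
    exact mul_le_mul_of_nonneg_right (sum_exp_ge hKpos c T _ (sum_bcount select y))
      (bdens_nonneg _ _ _ _)
  have hint : K * Real.exp (-c * (T / K)) ≤ K * (s * (2 - δ)) := by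
    have h := integral_mono ((integrable_bdens v hv select hsel (fun _ => 0) T).const_mul
      (K * Real.exp (-c * (T / K)))) (integrable_finsetSum Finset.univ fun i _ => hFi i) hpt
    rw [integral_const_mul, integral_bdens v hv select hsel, mul_one,
      integral_finsetSum _ fun i _ => hFi i] at h
    refine h.trans ((Finset.sum_le_sum fun i _ => hFint i).trans ?_)
    simp
  have hKR : (0 : ℝ) < K := by exact_mod_cast hKpos
  have hexp : Real.exp (-c * (T / K)) ≤ s * (2 - δ) := le_of_mul_le_mul_left hint hKR
  have hρ : 0 < s * (2 - δ) := mul_pos hspos (by linarith)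
  have hρ78 : s * (2 - δ) ≤ 7 / 8 := by rw [← hs2]; nlinarith [mul_pos hspos hspos]
  have hpow : (s * (2 - δ)) ^ 8 ≤ 2 * δ := by
    have h6 : (s * (2 - δ)) ^ 6 ≤ (7 / 8) ^ 6 := pow_le_pow_left₀ hρ.le hρ78 6
    have h2 : (s * (2 - δ)) ^ 2 ≤ 4 * δ := by
      rw [mul_pow, hs2]
      have : (2 - δ) ^ 2 ≤ 4 := by nlinarith
      nlinarith
    calc (s * (2 - δ)) ^ 8 = (s * (2 - δ)) ^ 6 * (s * (2 - δ)) ^ 2 := by ring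
      _ ≤ (7 / 8) ^ 6 * (4 * δ) := by gcongr
      _ ≤ 2 * δ := by nlinarith
  have hlog : -c * (T / K) * 8 ≤ Real.log (2 * δ) := by
    have h1 : -c * (T / K) ≤ Real.log (s * (2 - δ)) := (Real.le_log_iff_exp_le hρ).2 hexp
    have h2 := Real.log_le_log (by positivity) hpow
    rw [Real.log_pow] at h2
    push_cast at h2
    linarith
  have hL : Real.log (1 / (2 * δ)) = -Real.log (2 * δ) := by rw [one_div, Real.log_inv]
  have hLpos : Real.log (2 * δ) < 0 := Real.log_neg (by linarith) (by linarith)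
  rw [hL]
  set L := -Real.log (2 * δ) with hLdef
  have hL0 : 0 < L := by linarith
  have hcL : L * K ≤ 8 * c * T := by
    have : L ≤ 8 * c * T / K := by
      have e : 8 * c * T / K = -(-c * (T / K) * 8) := by ring
      rw [e]; linarith
    rwa [le_div_iff₀ hKR] at this
  have hc1 : c ≤ ε ^ 2 / σ ^ 2 := by
    rw [hc, hvc, hd, div_le_div_iff₀ (by positivity) (by positivity)]
    nlinarith [mul_pos (pow_pos hε 2) (pow_pos hσ 2)]
  have hTn : (0 : ℝ) ≤ T := Nat.cast_nonneg T
  have hfin : (K - 1) * L ≤ 8 * (ε ^ 2 / σ ^ 2) * T := by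
    have := mul_le_mul_of_nonneg_right hc1 hTn
    nlinarith
  have e2 : (K - 1 : ℝ) * (σ ^ 2 / (8 * ε ^ 2)) * L = (K - 1) * L * (σ ^ 2 / (8 * ε ^ 2)) := by ring
  rw [e2]
  calc ((K : ℝ) - 1) * L * (σ ^ 2 / (8 * ε ^ 2))
      ≤ 8 * (ε ^ 2 / σ ^ 2) * T * (σ ^ 2 / (8 * ε ^ 2)) := by gcongr
    _ = (T : ℝ) := by field_simp
end

section
/- Let P and Q be probability measures on a common measurable space and let A be a measurable event. Then the Kullback–Leibler divergence satisfies KL(P‖Q) ≥ P(A)·log(P(A)/Q(A)) + (1−P(A))·log((1−P(A))/(1−Q(A))), i.e., KL(P‖Q) is at least the binary KL divergence between the Bernoulli distributions with parameters P(A) and Q(A). -/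
open MeasureTheory
open scoped Classical

/-- The Kullback–Leibler divergence `KL(P‖Q)`: equal to `∫ log(dP/dQ) dP` when `P` is absolutely
continuous with respect to `Q` (and the integrand is integrable), and `+∞` otherwise. -/
noncomputable def klDiv {Ω : Type*} [MeasurableSpace Ω] (P Q : Measure Ω) : EReal :=
  if P ≪ Q ∧ Integrable (llr P Q) P then ((∫ ω, llr P Q ω ∂P : ℝ) : EReal) else ⊤

lemma aux_event {Ω : Type*} [MeasurableSpace Ω]
    (P Q : Measure Ω) [IsProbabilityMeasure P] [IsProbabilityMeasure Q]
    (hac : P ≪ Q) (hint : Integrable (llr P Q) P)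
    (B : Set Ω) (hB : MeasurableSet B) :
    (P B).toReal * Real.log ((P B).toReal / (Q B).toReal) ≤ ∫ ω in B, llr P Q ω ∂P := by
  by_cases hP : P B = 0
  · rw [Measure.restrict_eq_zero.mpr hP]; simp [hP]
  have hQ : Q B ≠ 0 := fun h => hP (hac h)
  have hp : 0 < (P B).toReal := ENNReal.toReal_pos hP (measure_ne_top _ _)
  have hq : 0 < (Q B).toReal := ENNReal.toReal_pos hQ (measure_ne_top _ _)
  set c := (P B).toReal / (Q B).toReal with hc
  have hc0 : 0 < c := div_pos hp hq
  have hcq : c * (Q B).toReal = (P B).toReal := by rw [hc]; field_simp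
  have hI : Integrable (fun x => (P.rnDeriv Q x).toReal) Q := Measure.integrable_toReal_rnDeriv
  have hI2 : Integrable (fun x => (P.rnDeriv Q x).toReal * llr P Q x) Q := by
    have := (integrable_rnDeriv_smul_iff (f := llr P Q) hac).mpr hint
    simpa [smul_eq_mul] using this
  have h1 : ∫ ω in B, llr P Q ω ∂P = ∫ x in B, (P.rnDeriv Q x).toReal * llr P Q x ∂Q := by
    rw [← setIntegral_rnDeriv_smul hac hB]; simp [smul_eq_mul]
  have h2 : ∫ x in B, (P.rnDeriv Q x).toReal ∂Q = (P B).toReal := by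
    rw [Measure.setIntegral_toReal_rnDeriv hac]; rfl
  have h3 : ∫ x in B, ((P.rnDeriv Q x).toReal * (Real.log c + 1) - c) ∂Q
      = (P B).toReal * Real.log c := by
    rw [integral_sub (hI.integrableOn.mul_const _) (integrable_const _), integral_mul_const, h2]
    simp [Measure.real]
    linarith
  rw [h1, ← h3]
  refine integral_mono ((hI.integrableOn.mul_const _).sub (integrable_const _)) hI2.integrableOn ?_
  intro x
  simp only [llr]
  rcases (ENNReal.toReal_nonneg : 0 ≤ (P.rnDeriv Q x).toReal).eq_or_lt with h | h
  · rw [← h]; simp [hc0.le]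
  · have := Real.log_le_sub_one_of_pos (div_pos hc0 h)
    rw [Real.log_div hc0.ne' h.ne'] at this
    have h4 := mul_le_mul_of_nonneg_left this h.le
    have h5 : (P.rnDeriv Q x).toReal * (c / (P.rnDeriv Q x).toReal - 1)
      = c - (P.rnDeriv Q x).toReal := by field_simp
    linarith

/-- For probability measures `P, Q` on a common measurable space and any
measurable event `A`, the Kullback–Leibler divergence `KL(P‖Q)` is at least the binary KL
divergence between the Bernoulli distributions with parameters `P(A)` and `Q(A)`:
`KL(P‖Q) ≥ P(A)·log(P(A)/Q(A)) + (1−P(A))·log((1−P(A))/(1−Q(A)))`. -/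
theorem klDiv_ge_binary_kl_of_event {Ω : Type*} [MeasurableSpace Ω]
    (P Q : Measure Ω) [IsProbabilityMeasure P] [IsProbabilityMeasure Q]
    (A : Set Ω) (hA : MeasurableSet A) :
    (((P A).toReal * Real.log ((P A).toReal / (Q A).toReal) +
        (1 - (P A).toReal) * Real.log ((1 - (P A).toReal) / (1 - (Q A).toReal)) : ℝ) : EReal) ≤
      klDiv P Q := by
  unfold klDiv
  split_ifs with h
  · obtain ⟨hac, hint⟩ := h
    rw [EReal.coe_le_coe_iff, ← integral_add_compl hA hint]
    have h1 := aux_event P Q hac hint A hA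
    have h2 := aux_event P Q hac hint Aᶜ hA.compl
    have e1 : (P Aᶜ).toReal = 1 - (P A).toReal := probReal_compl_eq_one_sub hA
    have e2 : (Q Aᶜ).toReal = 1 - (Q A).toReal := probReal_compl_eq_one_sub hA
    rw [e1, e2] at h2
    exact add_le_add h1 h2
  · exact le_top
end
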